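/- Lemma 2 (interference lower bound). Under the PIR-with-private-side-information setup, with S = {1,…,M}, demand set 𝒫 = {M+1,…,M+P}, and A_1 = A_1^{S,𝒫}, if P ≥ (K−M)/2 then H(A_1 | Q, W_S, W_𝒫) ≥ (K−M−P)·L / N. -/

import Mathlib

open scoped BigOperators

/-- Probability that random variable `X` takes the value `x`, under the
probability mass function `p` on the finite sample space `Ω`. -/
noncomputable def pr {Ω : Type} [Fintype Ω] (p : Ω → ℝ) {α : Type} [DecidableEq α]
    (X : Ω → α) (x : α) : ℝ :=
  ∑ ω ∈ Finset.univ.filter (fun ω => X ω = x), p ω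

/-- Shannon entropy of `X` in base `b` (with the convention `0 * log 0 = 0`). -/
noncomputable def ent {Ω : Type} [Fintype Ω] (b : ℝ) (p : Ω → ℝ) {α : Type} [Fintype α]
    [DecidableEq α] (X : Ω → α) : ℝ :=
  -∑ x : α, pr p X x * Real.logb b (pr p X x)

/-- Conditional entropy `H(X ∣ Y) = H(X, Y) - H(Y)`, in base `b`. -/
noncomputable def condEnt {Ω : Type} [Fintype Ω] (b : ℝ) (p : Ω → ℝ) {α β : Type} [Fintype α]
    [DecidableEq α] [Fintype β] [DecidableEq β] (X : Ω → α) (Y : Ω → β) : ℝ :=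
  ent b p (fun ω => (X ω, Y ω)) - ent b p Y

/-- `X` is a deterministic function of `Y`. -/
def detFn {Ω α β : Type} (X : Ω → α) (Y : Ω → β) : Prop :=
  ∃ f : β → α, ∀ ω, X ω = f (Y ω)

/-- Admissible demand sets: subsets of `{1,…,K} \ S` of size `P`
(indices are `0`-based, and `S = {1,…,M}` corresponds to indices `< M`). -/
def demands (K M P : ℕ) : Finset (Finset (Fin K)) :=
  Finset.univ.filter (fun T => T.card = P ∧ ∀ i ∈ T, M ≤ i.val)

section Entropy

variable {Ω : Type} [Fintype Ω] {p : Ω → ℝ}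

lemma pr_nonneg (hp : ∀ ω, 0 ≤ p ω) {α : Type} [DecidableEq α] (X : Ω → α) (x : α) :
    0 ≤ pr p X x :=
  Finset.sum_nonneg fun ω _ => hp ω

lemma le_pr_self (hp : ∀ ω, 0 ≤ p ω) {α : Type} [DecidableEq α] (X : Ω → α) (ω : Ω) :
    p ω ≤ pr p X (X ω) :=
  Finset.single_le_sum (f := p) (fun ω' _ => hp ω') (by simp)

/-- Change of variables: an expectation over the sample space is a sum over the values of `X`. -/
lemma sum_mul_comp {α : Type} [Fintype α] [DecidableEq α] (X : Ω → α) (g : α → ℝ) :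
    ∑ ω, p ω * g (X ω) = ∑ x, pr p X x * g x := by
  rw [← Finset.sum_fiberwise Finset.univ X]
  refine Finset.sum_congr rfl fun x _ => ?_
  rw [pr, Finset.sum_mul]
  refine Finset.sum_congr rfl fun ω hω => ?_
  rw [(Finset.mem_filter.mp hω).2]

lemma sum_pr {α : Type} [Fintype α] [DecidableEq α] (X : Ω → α) :
    ∑ x, pr p X x = ∑ ω, p ω := by
  simpa using (sum_mul_comp (p := p) X fun _ => 1).symm

lemma sum_pr_pair {α β : Type} [Fintype α] [DecidableEq α] [DecidableEq β]
    (X : Ω → α) (Y : Ω → β) (y : β) :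
    ∑ x, pr p (fun ω => (X ω, Y ω)) (x, y) = pr p Y y := by
  unfold pr
  rw [← Finset.sum_fiberwise (Finset.univ.filter fun ω => Y ω = y) X]
  refine Finset.sum_congr rfl fun x _ => Finset.sum_congr ?_ fun _ _ => rfl
  ext ω
  simp [and_comm]

lemma ent_eq_sum (b : ℝ) {α : Type} [Fintype α] [DecidableEq α] (X : Ω → α) :
    ent b p X = -∑ ω, p ω * Real.logb b (pr p X (X ω)) := by
  rw [ent, sum_mul_comp X fun x => Real.logb b (pr p X x)]

/-- Entropy is monotone: a function of `Y` has at most the entropy of `Y`. -/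
lemma ent_le_of_detFn {b : ℝ} (hb : 1 < b) (hp : ∀ ω, 0 ≤ p ω) {α β : Type}
    [Fintype α] [DecidableEq α] [Fintype β] [DecidableEq β] {X : Ω → α} {Y : Ω → β}
    (h : detFn X Y) : ent b p X ≤ ent b p Y := by
  obtain ⟨f, hf⟩ := h
  rw [ent_eq_sum, ent_eq_sum, neg_le_neg_iff]
  refine Finset.sum_le_sum fun ω _ => ?_
  rcases (hp ω).eq_or_lt with h0 | h0
  · simp [← h0]
  refine mul_le_mul_of_nonneg_left ?_ (hp ω)
  refine Real.logb_le_logb_of_le hb (h0.trans_le (le_pr_self hp Y ω)) ?_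
  refine Finset.sum_le_sum_of_subset_of_nonneg (fun ω' hω' => ?_) fun ω' _ _ => hp ω'
  simp only [Finset.mem_filter, Finset.mem_univ, true_and] at hω' ⊢
  rw [hf, hf, hω']

lemma ent_eq_of_detFn {b : ℝ} (hb : 1 < b) (hp : ∀ ω, 0 ≤ p ω) {α β : Type}
    [Fintype α] [DecidableEq α] [Fintype β] [DecidableEq β] {X : Ω → α} {Y : Ω → β}
    (h : detFn X Y) (h' : detFn Y X) : ent b p X = ent b p Y :=
  (ent_le_of_detFn hb hp h).antisymm (ent_le_of_detFn hb hp h')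

/-- Gibbs' inequality: cross entropy dominates entropy. -/
lemma ent_le_crossEntropy {b : ℝ} (hb : 1 < b) (hp : ∀ ω, 0 ≤ p ω) (hp1 : ∑ ω, p ω = 1)
    {α : Type} [Fintype α] [DecidableEq α] (X : Ω → α) (q : α → ℝ) (hq : ∀ x, 0 ≤ q x)
    (hq1 : ∑ x, q x ≤ 1) (hpos : ∀ ω, 0 < p ω → 0 < q (X ω)) :
    ent b p X ≤ -∑ ω, p ω * Real.logb b (q (X ω)) := by
  have hlog : 0 < Real.log b := Real.log_pos hb
  have hpt : ∀ ω, p ω * Real.log (q (X ω)) - p ω * Real.log (pr p X (X ω))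
      ≤ p ω * (q (X ω) / pr p X (X ω)) - p ω := by
    intro ω
    rcases (hp ω).eq_or_lt with h0 | h0
    · simp [← h0]
    have hX := h0.trans_le (le_pr_self hp X ω)
    have := Real.log_le_sub_one_of_pos (div_pos (hpos ω h0) hX)
    rw [Real.log_div (hpos ω h0).ne' hX.ne'] at this
    nlinarith
  have hsum := Finset.sum_le_sum fun ω (_ : ω ∈ Finset.univ) => hpt ω
  have hle : ∑ ω, p ω * (q (X ω) / pr p X (X ω)) ≤ 1 := by
    rw [sum_mul_comp X fun x => q x / pr p X x]
    refine le_trans (Finset.sum_le_sum fun x _ => ?_) hq1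
    rcases eq_or_ne (pr p X x) 0 with h0 | h0
    · simpa [h0] using hq x
    · rw [mul_div_cancel₀ _ h0]
  simp only [Finset.sum_sub_distrib, hp1] at hsum
  rw [ent_eq_sum, neg_le_neg_iff]
  simp only [Real.logb, ← mul_div_assoc, ← Finset.sum_div]
  exact div_le_div_of_nonneg_right (by linarith) hlog.le

lemma ent_pair_le_add_logb_card {b : ℝ} (hb : 1 < b) (hp : ∀ ω, 0 ≤ p ω)
    (hp1 : ∑ ω, p ω = 1) {α β : Type} [Fintype α] [DecidableEq α] [Fintype β] [DecidableEq β]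
    (X : Ω → α) (Y : Ω → β) :
    ent b p (fun ω => (X ω, Y ω)) ≤ ent b p Y + Real.logb b (Fintype.card α) := by
  obtain ⟨ω₀⟩ : Nonempty Ω := by
    by_contra h
    rw [not_nonempty_iff] at h
    simp at hp1
  have : Nonempty α := ⟨X ω₀⟩
  have hc : (0 : ℝ) < Fintype.card α := by exact_mod_cast Fintype.card_pos
  have hY : ∀ ω, 0 < p ω → 0 < pr p Y (Y ω) := fun ω h => h.trans_le (le_pr_self hp Y ω)
  refine (ent_le_crossEntropy hb hp hp1 (fun ω => (X ω, Y ω))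
    (fun z => pr p Y z.2 / Fintype.card α) (fun z => div_nonneg (pr_nonneg hp _ _) hc.le) ?_
    fun ω h => div_pos (hY ω h) hc).trans_eq ?_
  · rw [Fintype.sum_prod_type]
    simp only [← Finset.sum_div, sum_pr, hp1]
    simp [hc.ne']
  · have : ∀ ω, p ω * Real.logb b (pr p Y (Y ω) / Fintype.card α)
        = p ω * Real.logb b (pr p Y (Y ω)) - p ω * Real.logb b (Fintype.card α) := by
      intro ω
      rcases (hp ω).eq_or_lt with h0 | h0
      · simp [← h0]
      rw [Real.logb_div (hY ω h0).ne' hc.ne', mul_sub]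
    simp only [this, Finset.sum_sub_distrib, ← Finset.sum_mul, hp1, ent_eq_sum]
    ring

/-- Submodularity of entropy. -/
lemma ent_submodular {b : ℝ} (hb : 1 < b) (hp : ∀ ω, 0 ≤ p ω) (hp1 : ∑ ω, p ω = 1)
    {α β γ : Type} [Fintype α] [DecidableEq α] [Fintype β] [DecidableEq β]
    [Fintype γ] [DecidableEq γ] (X : Ω → α) (Y : Ω → β) (Z : Ω → γ) :
    ent b p (fun ω => (X ω, Y ω, Z ω)) + ent b p Z
      ≤ ent b p (fun ω => (X ω, Z ω)) + ent b p (fun ω => (Y ω, Z ω)) := by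
  set XZ : Ω → α × γ := fun ω => (X ω, Z ω) with hXZ
  set YZ : Ω → β × γ := fun ω => (Y ω, Z ω) with hYZ
  have hpos : ∀ {δ : Type} [DecidableEq δ] (V : Ω → δ) (ω), 0 < p ω → 0 < pr p V (V ω) :=
    fun V ω h => h.trans_le (le_pr_self hp V ω)
  have hgibbs := ent_le_crossEntropy hb hp hp1 (fun ω => (X ω, Y ω, Z ω))
    (fun t => pr p XZ (t.1, t.2.2) * pr p YZ t.2 / pr p Z t.2.2)
    (fun t => div_nonneg (mul_nonneg (pr_nonneg hp _ _) (pr_nonneg hp _ _)) (pr_nonneg hp _ _))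
    (by
      rw [Fintype.sum_prod_type_right, Fintype.sum_prod_type_right]
      simp only [← Finset.sum_div, ← Finset.sum_mul, ← Finset.mul_sum]
      simp only [hXZ, hYZ, sum_pr_pair, mul_self_div_self, sum_pr, hp1, le_refl])
    (fun ω h => div_pos (mul_pos (hpos XZ ω h) (hpos YZ ω h)) (hpos Z ω h))
  have hsplit : ∀ ω, p ω * Real.logb b (pr p XZ (X ω, Z ω) * pr p YZ (Y ω, Z ω) / pr p Z (Z ω))
      = p ω * Real.logb b (pr p XZ (XZ ω)) + p ω * Real.logb b (pr p YZ (YZ ω))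
        - p ω * Real.logb b (pr p Z (Z ω)) := by
    intro ω
    rcases (hp ω).eq_or_lt with h0 | h0
    · simp [← h0]
    have h1 := hpos XZ ω h0
    have h2 := hpos YZ ω h0
    rw [Real.logb_div (mul_pos h1 h2).ne' (hpos Z ω h0).ne', Real.logb_mul h1.ne' h2.ne']
    ring
  simp only [hsplit, Finset.sum_sub_distrib, Finset.sum_add_distrib] at hgibbs
  rw [ent_eq_sum b Z, ent_eq_sum b XZ, ent_eq_sum b YZ]
  linarith

lemma condEnt_congr_right {b : ℝ} (hb : 1 < b) (hp : ∀ ω, 0 ≤ p ω) {α β γ : Type}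
    [Fintype α] [DecidableEq α] [Fintype β] [DecidableEq β] [Fintype γ] [DecidableEq γ]
    (X : Ω → α) {Y : Ω → β} {Z : Ω → γ} (hYZ : detFn Y Z) (hZY : detFn Z Y) :
    condEnt b p X Y = condEnt b p X Z := by
  obtain ⟨f, hf⟩ := hYZ
  obtain ⟨g, hg⟩ := hZY
  refine congrArg₂ (· - ·) (ent_eq_of_detFn hb hp ?_ ?_)
    (ent_eq_of_detFn hb hp ⟨f, hf⟩ ⟨g, hg⟩)
  · exact ⟨fun t => (t.1, f t.2), fun ω => Prod.ext rfl (hf ω)⟩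
  · exact ⟨fun t => (t.1, g t.2), fun ω => Prod.ext rfl (hg ω)⟩

lemma condEnt_subset_le_sum {b : ℝ} (hb : 1 < b) (hp : ∀ ω, 0 ≤ p ω) (hp1 : ∑ ω, p ω = 1)
    {ι α β : Type} [DecidableEq ι] [Fintype α] [DecidableEq α] [Fintype β]
    [DecidableEq β] (X : ι → Ω → α) (Y : Ω → β) (s : Finset ι) :
    condEnt b p (fun ω (i : ↥s) => X i ω) Y ≤ ∑ i ∈ s, condEnt b p (X i) Y := by
  induction s using Finset.induction_on with
  | empty =>
    have := ent_le_of_detFn (b := b) hb hp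
      (X := fun ω => ((fun i : ↥(∅ : Finset ι) => X i ω), Y ω)) (Y := Y)
      ⟨fun y => (fun i => absurd i.2 (Finset.notMem_empty _), y),
        fun ω => Prod.ext (funext fun i => absurd i.2 (Finset.notMem_empty _)) rfl⟩
    simpa [condEnt] using this
  | insert a s ha ih =>
    rw [Finset.sum_insert ha]
    have hdet : detFn (fun ω => ((fun i : ↥(insert a s) => X i ω), Y ω))
        (fun ω => (X a ω, (fun i : ↥s => X i ω), Y ω)) := by
      refine ⟨fun t => (fun i => if h : i.1 ∈ s then t.2.1 ⟨i.1, h⟩ else t.1, t.2.2),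
        fun ω => Prod.ext (funext fun i => ?_) rfl⟩
      by_cases h : i.1 ∈ s
      · simp [h]
      · simp [(Finset.mem_insert.mp i.2).resolve_right h]
    have h1 := ent_le_of_detFn (b := b) hb hp hdet
    have h2 := ent_submodular hb hp hp1 (X a) (fun ω (i : ↥s) => X i ω) Y
    unfold condEnt at ih ⊢
    linarith

/-- Conditional entropy of a finite family is subadditive. -/
lemma condEnt_pi_le_sum {b : ℝ} (hb : 1 < b) (hp : ∀ ω, 0 ≤ p ω) (hp1 : ∑ ω, p ω = 1)
    {ι α β : Type} [Fintype ι] [DecidableEq ι] [Fintype α] [DecidableEq α] [Fintype β]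
    [DecidableEq β] (X : ι → Ω → α) (Y : Ω → β) :
    condEnt b p (fun ω i => X i ω) Y ≤ ∑ i, condEnt b p (X i) Y := by
  refine le_trans ?_ (condEnt_subset_le_sum hb hp hp1 X Y Finset.univ)
  refine sub_le_sub_right (ent_le_of_detFn hb hp ?_) _
  exact ⟨fun t => (fun i => t.1 ⟨i, Finset.mem_univ i⟩, t.2), fun ω => rfl⟩

/-- If `X` is uniform on a set of `c` values and independent of `Y`, then
`H(X, Y) = H(Y) + log c`. -/
lemma ent_pair_of_uniform_indep (b : ℝ) (hp : ∀ ω, 0 ≤ p ω) (hp1 : ∑ ω, p ω = 1)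
    {α β : Type} [Fintype α] [DecidableEq α] [Fintype β] [DecidableEq β]
    (X : Ω → α) (Y : Ω → β) {c : ℝ} (hc : 0 < c)
    (h : ∀ x y, pr p (fun ω => (X ω, Y ω)) (x, y) = c⁻¹ * pr p Y y) :
    ent b p (fun ω => (X ω, Y ω)) = ent b p Y + Real.logb b c := by
  have : ∀ ω, p ω * Real.logb b (pr p (fun ω => (X ω, Y ω)) (X ω, Y ω))
      = p ω * Real.logb b (pr p Y (Y ω)) - p ω * Real.logb b c := by
    intro ω
    rcases (hp ω).eq_or_lt with h0 | h0
    · simp [← h0]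
    rw [h, Real.logb_mul (inv_pos.mpr hc).ne' (h0.trans_le (le_pr_self hp Y ω)).ne',
      Real.logb_inv]
    ring
  simp only [ent_eq_sum, this, Finset.sum_sub_distrib, ← Finset.sum_mul, hp1]
  ring

end Entropy

/-- When `K ≤ M + 2 * P`, some admissible demand set contains every index that is at
least `M + P`. -/
lemma exists_demand_superset {K M P : ℕ} (hMPK : M + P ≤ K) (hK : K ≤ M + 2 * P) :
    ∃ d ∈ demands K M P, ∀ i : Fin K, M + P ≤ i.val → i ∈ d := by
  have hcard : ∀ m, (Finset.univ.filter fun i : Fin K => m ≤ i.val).card = K - min K m := by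
    intro m
    have h := Finset.card_filter_add_card_filter_not (s := Finset.univ) fun i : Fin K => i.val < m
    simp only [Fin.card_filter_val_lt, not_lt, Finset.card_univ, Fintype.card_fin] at h
    omega
  obtain ⟨d, hRd, hdU, hd⟩ := Finset.exists_subsuperset_card_eq (n := P)
    (s := Finset.univ.filter fun i : Fin K => M + P ≤ i.val)
    (t := Finset.univ.filter fun i : Fin K => M ≤ i.val)
    (Finset.monotone_filter_right _ fun i _ h => (Nat.le_add_right M P).trans h)
    (by rw [hcard]; omega) (by rw [hcard]; omega)
  refine ⟨d, ?_, fun i hi => hRd (by simpa using hi)⟩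
  simp only [demands, Finset.mem_filter, Finset.mem_univ, true_and]
  exact ⟨hd, fun i hi => by simpa using hdU hi⟩

/-- Lemma 2 of the paper (interference lower bound): if `P ≥ (K-M)/2` then
`H(A₁ ∣ Q, W_S, W_𝒫) ≥ (K-M-P)·L / N`. -/
theorem lemma2_interference_lower_bound
    (F : Type) [Field F] [Fintype F] [DecidableEq F]
    (QT AT : Type) [Fintype QT] [DecidableEq QT] [Fintype AT] [DecidableEq AT]
    (Ω : Type) [Fintype Ω]
    (p : Ω → ℝ) (hp0 : ∀ ω, 0 ≤ p ω) (hp1 : ∑ ω, p ω = 1)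
    (N K L M P : ℕ) (hN : 0 < N) (hMPK : M + P ≤ K)
    (W : Fin K → Ω → (Fin L → F))
    (Qu : ↥(demands K M P) → Fin N → Ω → QT)
    (A : ↥(demands K M P) → Fin N → Ω → AT)
    (Qall : Ω → (↥(demands K M P) → Fin N → QT))
    (hQall : Qall = fun ω d n => Qu d n ω)
    (S : Finset (Fin K)) (hS : S = Finset.univ.filter (fun i => i.val < M))
    (Pd : Finset (Fin K))
    (hPdDef : Pd = Finset.univ.filter (fun i => M ≤ i.val ∧ i.val < M + P))
    (hPd : Pd ∈ demands K M P)
    -- the files are i.i.d. uniform on `F^L` and independent of all the queries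
    (hUnif : ∀ (w : Fin K → Fin L → F) (q : ↥(demands K M P) → Fin N → QT),
      pr p (fun ω => ((fun i => W i ω), Qall ω)) (w, q)
        = ((Fintype.card F : ℝ) ^ (K * L))⁻¹ * pr p Qall q)
    -- each answer is a deterministic function of the library and the received query
    (hAns : ∀ (d : ↥(demands K M P)) (n : Fin N),
      detFn (A d n) (fun ω => ((fun i => W i ω), Qu d n ω)))
    -- decodability
    (hDec : ∀ d : ↥(demands K M P),
      detFn (fun ω => (fun i : ↥(d : Finset (Fin K)) => W i.val ω))
        (fun ω => ((fun n => A d n ω), Qall ω, (fun i : ↥S => W i.val ω))))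
    -- privacy/symmetry (i)
    (hSym : ∀ (n : Fin N) (d d' : ↥(demands K M P)) (T : Finset (Fin K)),
      condEnt (Fintype.card F) p (A d n)
          (fun ω => (Qall ω, (fun i : ↥T => W i.val ω)))
        = condEnt (Fintype.card F) p (A d' ⟨0, hN⟩)
          (fun ω => (Qall ω, (fun i : ↥T => W i.val ω))))
    -- privacy/symmetry (ii)
    (hMix : ∀ (n : Fin N) (d d' : ↥(demands K M P)),
      detFn (fun ω => (fun i : ↥(d : Finset (Fin K)) => W i.val ω))
        (fun ω => ((fun m : Fin N => if m = n then A d' n ω else A d m ω),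
          Qall ω, (fun i : ↥S => W i.val ω))))
    (hReg : ((K : ℝ) - M) / 2 ≤ P) :
    ((K : ℝ) - M - P) * L / N
      ≤ condEnt (Fintype.card F) p (A ⟨Pd, hPd⟩ ⟨0, hN⟩)
          (fun ω => (Qall ω, (fun i : ↥S => W i.val ω), (fun i : ↥Pd => W i.val ω))) := by
  have hb : (1 : ℝ) < Fintype.card F := by exact_mod_cast Fintype.one_lt_card
  have hb0 : (0 : ℝ) < Fintype.card F := one_pos.trans hb
  have hlog : ∀ m : ℕ, Real.logb (Fintype.card F) ((Fintype.card F : ℝ) ^ m) = m := fun m => by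
    rw [Real.logb_pow, Real.logb_self_eq_one hb, mul_one]
  have hK : K ≤ M + 2 * P := by
    have : (K : ℝ) ≤ M + 2 * P := by linarith
    exact_mod_cast this
  obtain ⟨d, hd, hdR⟩ := exists_demand_superset hMPK hK
  have hmem : ∀ i, i ∉ d → i ∈ S ∪ Pd := by
    intro i hi
    have := mt (hdR i) hi
    simp only [hS, hPdDef, Finset.mem_union, Finset.mem_filter, Finset.mem_univ, true_and]
    omega
  have hcard : (S ∪ Pd).card ≤ M + P := by
    refine (Finset.card_union_le S Pd).trans (add_le_add ?_ ?_)
    · rw [hS, Fin.card_filter_val_lt]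
      exact min_le_right _ _
    · exact (Finset.mem_filter.mp hPd).2.1.le
  set Y : Ω → _ := fun ω => (Qall ω, (fun i : ↥(S ∪ Pd) => W i.val ω)) with hY
  -- the answers to `d`, together with `W_S` and `W_𝒫`, determine the whole library
  have hlib : ent (Fintype.card F) p Qall + (K * L : ℕ)
      ≤ ent (Fintype.card F) p (fun ω => ((fun n => A ⟨d, hd⟩ n ω), Y ω)) := by
    rw [← hlog (K * L), ← ent_pair_of_uniform_indep _ hp0 hp1 (fun ω i => W i ω) Qall
      (pow_pos hb0 _) hUnif]
    refine ent_le_of_detFn hb hp0 ?_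
    obtain ⟨f, hf⟩ := hDec ⟨d, hd⟩
    refine ⟨fun t => (fun i => if h : i ∈ d then
        f (t.1, t.2.1, fun j => t.2.2 ⟨j.1, Finset.mem_union_left _ j.2⟩) ⟨i, h⟩
      else t.2.2 ⟨i, hmem i h⟩, t.2.1), fun ω => Prod.ext (funext fun i => ?_) rfl⟩
    by_cases h : i ∈ d
    · simpa [h, hY] using congrFun (hf ω) ⟨i, h⟩
    · simp [h, hY]
  have hside : ent (Fintype.card F) p Y ≤ ent (Fintype.card F) p Qall + ((M + P) * L : ℕ) := by
    calc ent (Fintype.card F) p Y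
        ≤ ent (Fintype.card F) p (fun ω => ((fun i : ↥(S ∪ Pd) => W i.val ω), Qall ω)) :=
          ent_le_of_detFn hb hp0 ⟨Prod.swap, fun ω => rfl⟩
      _ ≤ _ := ent_pair_le_add_logb_card hb hp0 hp1 _ _
      _ = ent (Fintype.card F) p Qall + ((S ∪ Pd).card * L : ℕ) := by
          have : (Fintype.card (↥(S ∪ Pd) → Fin L → F) : ℝ)
              = (Fintype.card F : ℝ) ^ ((S ∪ Pd).card * L) := by
            rw [Fintype.card_fun, Fintype.card_fun, Fintype.card_coe, Fintype.card_fin, ← pow_mul,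
              mul_comm L]
            push_cast
            rfl
          rw [this, hlog]
      _ ≤ _ := by gcongr
  have hsum := condEnt_pi_le_sum hb hp0 hp1 (A ⟨d, hd⟩) Y
  rw [Finset.sum_congr rfl fun n _ => hSym n ⟨d, hd⟩ ⟨Pd, hPd⟩ (S ∪ Pd)] at hsum
  have hcond : condEnt (Fintype.card F) p (A ⟨Pd, hPd⟩ ⟨0, hN⟩) Y
      = condEnt (Fintype.card F) p (A ⟨Pd, hPd⟩ ⟨0, hN⟩)
        (fun ω => (Qall ω, (fun i : ↥S => W i.val ω), (fun i : ↥Pd => W i.val ω))) := by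
    let split : (↥(S ∪ Pd) → Fin L → F) → (↥S → Fin L → F) × (↥Pd → Fin L → F) := fun w =>
      (fun i => w ⟨i.1, Finset.mem_union_left _ i.2⟩,
        fun i => w ⟨i.1, Finset.mem_union_right _ i.2⟩)
    let glue : (↥S → Fin L → F) × (↥Pd → Fin L → F) → ↥(S ∪ Pd) → Fin L → F := fun w i =>
      if h : i.1 ∈ S then w.1 ⟨i.1, h⟩
      else w.2 ⟨i.1, (Finset.mem_union.mp i.2).resolve_left h⟩
    have hglue : ∀ ω, (fun i : ↥(S ∪ Pd) => W i.val ω)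
        = glue (fun i : ↥S => W i.val ω, fun i : ↥Pd => W i.val ω) := by
      intro ω
      funext i
      by_cases h : i.1 ∈ S <;> simp [glue, h]
    exact condEnt_congr_right hb hp0 _
      ⟨fun t => (t.1, glue t.2), fun ω => by simp only [hY, hglue]⟩
      ⟨fun t => (t.1, split t.2), fun ω => rfl⟩
  rw [← hcond, div_le_iff₀ (by exact_mod_cast hN)]
  simp only [Finset.sum_const, Finset.card_univ, Fintype.card_fin, nsmul_eq_mul] at hsum
  rw [← hY] at hsum
  rw [condEnt] at hsum
  push_cast at hlib hside
  linarith
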